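/- Let Z = {z_1,…,z_K} be drawn i.i.d. from the probability measure ρ on Ω, and let τ = (1/K)Σ_i δ_{z_i}. If K ≥ N(P,ρ)^2 · ((1−δ)log(1−δ)+δ)^{-1} · log(N/γ), then with probability at least 1−γ, the constant D = sup{||p||_{L^2(Ω,ρ)}/||p||_{L^2(Ω,τ)} : p ∈ P, p ≠ 0} satisfies D ≤ 1/√(1−δ). -/

import Mathlib

open MeasureTheory

set_option linter.unusedSectionVars false
namespace S15
open Matrix
open scoped ComplexOrder

section tr
variable {n : Type*} [Fintype n] [DecidableEq n]

lemma trace_pow_comm (X Y : Matrix n n ℂ) (k : ℕ) :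
    ((X * Y) ^ k).trace = ((Y * X) ^ k).trace := by
  cases k with
  | zero => simp
  | succ k =>
    rw [pow_succ, ← mul_assoc, mul_pow_mul, Matrix.trace_mul_comm, ← mul_assoc, ← pow_succ']

lemma amgm (X Y : Matrix n n ℂ) :
    (X * Y).trace.re ≤ ((X * Xᴴ).trace.re + (Yᴴ * Y).trace.re) / 2 := by
  have h := (posSemidef_self_mul_conjTranspose (X - Yᴴ)).trace_nonneg
  have h2 := (Complex.le_def.1 h).1
  have h3 : (Yᴴ * Xᴴ).trace.re = (X * Y).trace.re := by
    rw [← conjTranspose_mul, trace_conjTranspose]; simp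
  simp only [conjTranspose_sub, conjTranspose_conjTranspose, sub_mul, mul_sub, trace_sub,
    Complex.sub_re, h3, Complex.zero_re] at h2
  linarith

lemma tr_both (k : ℕ) :
    (∀ M : Matrix n n ℂ, (M ^ (2 ^ (k + 1))).trace.re ≤ ((M * Mᴴ) ^ (2 ^ k)).trace.re) ∧
    (∀ A B : Matrix n n ℂ, A.IsHermitian → B.IsHermitian →
      ((A * B) ^ (2 ^ k)).trace.re ≤ (A ^ (2 ^ k) * B ^ (2 ^ k)).trace.re) := by
  induction k with
  | zero =>
    refine ⟨fun M => ?_, fun A B _ _ => by simp⟩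
    have := amgm M M
    rw [Matrix.trace_mul_comm Mᴴ M] at this
    simp only [zero_add, pow_one, pow_zero, pow_two]
    linarith
  | succ k ih =>
    obtain ⟨hC, hG⟩ := ih
    constructor
    · intro M
      have h1 := hC (M ^ 2)
      have e1 : (M ^ 2) * (M ^ 2)ᴴ = M * (M * Mᴴ * Mᴴ) := by
        simp only [pow_two, conjTranspose_mul, mul_assoc]
      have e2 : (M * Mᴴ * Mᴴ) * M = (M * Mᴴ) * (Mᴴ * M) := by simp only [mul_assoc]
      rw [e1, trace_pow_comm, e2] at h1
      have h2 := hG (M * Mᴴ) (Mᴴ * M) (isHermitian_mul_conjTranspose_self M)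
        (isHermitian_conjTranspose_mul_self M)
      have h3 := amgm ((M * Mᴴ) ^ (2 ^ k)) ((Mᴴ * M) ^ (2 ^ k))
      rw [((isHermitian_mul_conjTranspose_self M).pow _).eq,
        ((isHermitian_conjTranspose_mul_self M).pow _).eq, ← pow_add, ← pow_add,
        trace_pow_comm Mᴴ M] at h3
      rw [← pow_mul, ← pow_succ'] at h1
      have e4 : 2 ^ k + 2 ^ k = 2 ^ (k + 1) := by ring
      rw [e4] at h3
      linarith
    · intro A B hA hB
      have h1 := hC (A * B)
      have e1 : (A * B) * (A * B)ᴴ = A * (B * B * A) := by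
        simp only [conjTranspose_mul, mul_assoc, hA.eq, hB.eq]
      have e2 : (B * B * A) * A = B ^ 2 * A ^ 2 := by simp only [mul_assoc, pow_two]
      rw [e1, trace_pow_comm A (B * B * A), e2, trace_pow_comm (B ^ 2)] at h1
      have h2 := hG (A ^ 2) (B ^ 2) (hA.pow 2) (hB.pow 2)
      rw [← pow_mul, ← pow_mul, ← pow_succ'] at h2
      linarith

end tr

section trotter
open Filter Topology NormedSpace
variable {𝔸 : Type*} [NormedRing 𝔸] [NormedAlgebra ℝ 𝔸] [CompleteSpace 𝔸] [NormOneClass 𝔸]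

lemma norm_exp_le' (x : 𝔸) : ‖exp x‖ ≤ Real.exp ‖x‖ := by
  rw [exp_eq_tsum ℝ, Real.exp_eq_exp_ℝ, exp_eq_tsum ℝ]
  refine tsum_of_norm_bounded (expSeries_summable' (𝕂 := ℝ) ‖x‖).hasSum fun i => ?_
  rw [norm_smul, smul_eq_mul, Real.norm_of_nonneg (by positivity)]
  gcongr
  exact norm_pow_le _ _

lemma norm_pow_sub_pow (X Y : 𝔸) (c : ℝ) (hX : ‖X‖ ≤ c) (hY : ‖Y‖ ≤ c) (hc : 1 ≤ c) (n : ℕ) :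
    ‖X ^ n - Y ^ n‖ ≤ n * ‖X - Y‖ * c ^ n := by
  induction n with
  | zero => simp
  | succ n ih =>
    have : X ^ (n + 1) - Y ^ (n + 1) = X ^ n * (X - Y) + (X ^ n - Y ^ n) * Y := by
      rw [pow_succ, pow_succ]; noncomm_ring
    rw [this]
    have h1 : ‖X ^ n * (X - Y)‖ ≤ c ^ n * ‖X - Y‖ :=
      (norm_mul_le _ _).trans (by gcongr; exact (norm_pow_le _ _).trans (by gcongr))
    have h2 : ‖(X ^ n - Y ^ n) * Y‖ ≤ n * ‖X - Y‖ * c ^ n * c :=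
      (norm_mul_le _ _).trans (by gcongr)
    have h3 : c ^ n * ‖X - Y‖ ≤ c ^ n * ‖X - Y‖ * c := le_mul_of_one_le_right (by positivity) hc
    refine (norm_add_le _ _).trans ?_
    push_cast
    rw [pow_succ]
    nlinarith

lemma trotter (A B : 𝔸) :
    Tendsto (fun k : ℕ => (exp (((2:ℝ) ^ k)⁻¹ • A) * exp (((2:ℝ) ^ k)⁻¹ • B)) ^ (2 ^ k)) atTop
      (𝓝 (exp (A + B))) := by
  have hd : HasDerivAt (fun t : ℝ => exp (t • A) * exp (t • B) - exp (t • (A + B))) 0 0 := by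
    have h1 := hasDerivAt_exp_smul_const (𝕂 := ℝ) A 0
    have h2 := hasDerivAt_exp_smul_const (𝕂 := ℝ) B 0
    have h3 := hasDerivAt_exp_smul_const (𝕂 := ℝ) (A + B) 0
    have h4 := (h1.mul h2).sub h3
    have e : exp ((0:ℝ) • A) * A * exp ((0:ℝ) • B) + exp ((0:ℝ) • A) * (exp ((0:ℝ) • B) * B)
        - exp ((0:ℝ) • (A + B)) * (A + B) = 0 := by simp
    rw [e] at h4
    exact h4
  have ho := hasDerivAt_iff_tendsto.1 hd
  have ht : Tendsto (fun k : ℕ => ((2:ℝ) ^ k)⁻¹) atTop (𝓝 0) := by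
    simpa using tendsto_pow_atTop_nhds_zero_of_lt_one (r := (2:ℝ)⁻¹) (by norm_num) (by norm_num)
  have h4 := (ho.comp ht).mul_const (Real.exp (‖A‖ + ‖B‖))
  rw [tendsto_iff_norm_sub_tendsto_zero]
  refine squeeze_zero (fun _ => norm_nonneg _) (fun k => ?_) (by simpa using h4)
  set t : ℝ := ((2:ℝ) ^ k)⁻¹ with htdef
  have htp : 0 < t := by positivity
  have hY : exp (A + B) = exp (t • (A + B)) ^ (2 ^ k) := by
    let _ := NormedAlgebra.restrictScalars ℚ ℝ 𝔸
    rw [← NormedSpace.exp_nsmul, ← Nat.cast_smul_eq_nsmul ℝ, smul_smul]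
    simp [htdef]
  rw [hY]
  have b1 : ∀ Z : 𝔸, ‖exp (t • Z)‖ ≤ Real.exp (t * ‖Z‖) := fun Z => by
    have := norm_exp_le' (t • Z)
    rwa [norm_smul, Real.norm_of_nonneg htp.le] at this
  refine (norm_pow_sub_pow _ _ (Real.exp (t * (‖A‖ + ‖B‖))) ?_ ?_ ?_ _).trans ?_
  · refine (norm_mul_le _ _).trans ?_
    rw [mul_add, Real.exp_add]
    gcongr
    exacts [b1 A, b1 B]
  · refine (b1 _).trans ?_
    gcongr
    exact norm_add_le _ _
  · exact Real.one_le_exp (by positivity)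
  · rw [← Real.exp_nat_mul]
    have e : ((2 ^ k : ℕ) : ℝ) * (t * (‖A‖ + ‖B‖)) = ‖A‖ + ‖B‖ := by
      rw [← mul_assoc]; simp [htdef]
    rw [e]
    simp [htdef]
end trotter

section gt
open Filter Topology NormedSpace
variable {n : Type*} [Fintype n] [DecidableEq n] [Nonempty n]

attribute [local instance] Matrix.linftyOpNormedRing Matrix.linftyOpNormedAlgebra

lemma golden_thompson (A B : Matrix n n ℂ) (hA : A.IsHermitian) (hB : B.IsHermitian) :
    (exp (A + B)).trace.re ≤ (exp A * exp B).trace.re := by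
  have h := trotter A B
  have h2 : Tendsto (fun k : ℕ => ((exp (((2:ℝ) ^ k)⁻¹ • A) * exp (((2:ℝ) ^ k)⁻¹ • B)) ^ (2 ^ k)).trace.re)
      atTop (𝓝 (exp (A + B)).trace.re) := by
    have hc : Continuous fun M : Matrix n n ℂ => M.trace.re :=
      Complex.continuous_re.comp (continuous_id.matrix_trace)
    exact (hc.tendsto _).comp h
  refine le_of_tendsto' h2 fun k => ?_
  have key : ∀ C : Matrix n n ℂ, exp (((2:ℝ) ^ k)⁻¹ • C) ^ (2 ^ k) = exp C := fun C => by
    rw [← Matrix.exp_nsmul, ← Nat.cast_smul_eq_nsmul ℝ, smul_smul]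
    simp
  have hh : ∀ C : Matrix n n ℂ, C.IsHermitian → (((2:ℝ) ^ k)⁻¹ • C).IsHermitian := fun C hC => by
    rw [Matrix.IsHermitian, conjTranspose_smul, hC.eq]; simp
  have := (tr_both (n := n) k).2 _ _ (hh A hA).exp (hh B hB).exp
  rwa [key, key] at this
end gt

section spec
open NormedSpace
variable {n : Type*} [Fintype n] [DecidableEq n]

lemma spec_form {A : Matrix n n ℂ} (hA : A.IsHermitian) (t c d : ℝ) :
    ∃ U : (Matrix n n ℂ)ˣ, star (U : Matrix n n ℂ) = ((U⁻¹ : (Matrix n n ℂ)ˣ) : Matrix n n ℂ) ∧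
      A = U * diagonal (fun i => ((hA.eigenvalues i : ℝ) : ℂ)) * star (U : Matrix n n ℂ) ∧
      (exp (t • A) = U * diagonal (fun i => ((Real.exp (t * hA.eigenvalues i) : ℝ) : ℂ))
        * star (U : Matrix n n ℂ)) ∧
      c • (1 : Matrix n n ℂ) + d • A = U * diagonal (fun i => ((c + d * hA.eigenvalues i : ℝ) : ℂ))
        * star (U : Matrix n n ℂ) := by
  set U : (Matrix n n ℂ)ˣ := Unitary.toUnits hA.eigenvectorUnitary with hU
  have hs : star (U : Matrix n n ℂ) = ((U⁻¹ : (Matrix n n ℂ)ˣ) : Matrix n n ℂ) := rfl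
  have hsp : A = U * diagonal (fun i => ((hA.eigenvalues i : ℝ) : ℂ)) * star (U : Matrix n n ℂ) := by
    conv_lhs => rw [hA.spectral_theorem]
    rfl
  refine ⟨U, hs, hsp, ?_, ?_⟩
  · have e1 : t • A = U * diagonal (fun i => ((t * hA.eigenvalues i : ℝ) : ℂ))
        * ((U⁻¹ : (Matrix n n ℂ)ˣ) : Matrix n n ℂ) := by
      conv_lhs => rw [hsp]
      rw [hs, ← smul_mul_assoc, ← mul_smul_comm]
      congr 2
      ext i j
      by_cases h : i = j <;> simp [diagonal, h]
    rw [e1, Matrix.exp_units_conj, Matrix.exp_diagonal, hs]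
    congr 3
    ext i
    rw [Pi.exp_def]
    simp [Complex.exp_eq_exp_ℂ]
  · have e2 : diagonal (fun i => ((c + d * hA.eigenvalues i : ℝ) : ℂ)) =
        c • (1 : Matrix n n ℂ) + d • diagonal (fun i => ((hA.eigenvalues i : ℝ) : ℂ)) := by
      ext i j
      by_cases h : i = j <;> simp [diagonal, h]
    rw [e2, mul_add, add_mul, mul_smul_comm, mul_smul_comm, smul_mul_assoc, smul_mul_assoc, ← hsp,
      mul_one, hs, Units.mul_inv]

lemma exp_herm_smul {A : Matrix n n ℂ} (hA : A.IsHermitian) (t : ℝ) : (t • A).IsHermitian := by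
  rw [Matrix.IsHermitian, conjTranspose_smul, hA.eq]; simp

lemma trace_exp_mul_nonneg {A D : Matrix n n ℂ} (hA : A.IsHermitian) (hD : D.PosSemidef) :
    0 ≤ (exp A * D).trace.re := by
  have hE : (exp ((2⁻¹ : ℝ) • A)).IsHermitian := (exp_herm_smul hA _).exp
  have e : exp A = exp ((2⁻¹ : ℝ) • A) * exp ((2⁻¹ : ℝ) • A) := by
    rw [← Matrix.exp_add_of_commute _ _ (Commute.refl _), ← add_smul]; norm_num
  rw [e, mul_assoc, Matrix.trace_mul_comm]
  have := (hD.mul_mul_conjTranspose_same (exp ((2⁻¹ : ℝ) • A))).trace_nonneg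
  rw [hE.eq] at this
  exact (Complex.le_def.1 this).1

lemma trace_exp_nonneg {A : Matrix n n ℂ} (hA : A.IsHermitian) : 0 ≤ (exp A).trace.re := by
  simpa using trace_exp_mul_nonneg hA PosSemidef.one

lemma chord {R θ l : ℝ} (hR : 0 < R) (h0 : 0 ≤ l) (h1 : l ≤ R) :
    Real.exp (-θ * l) ≤ 1 - (1 - Real.exp (-θ * R)) / R * l := by
  have hc := convexOn_exp.2 (Set.mem_univ (0:ℝ)) (Set.mem_univ (-θ * R))
    (show (0:ℝ) ≤ 1 - l / R by rw [sub_nonneg, div_le_one hR]; exact h1)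
    (show (0:ℝ) ≤ l / R by positivity) (by ring)
  have e : (1 - l / R) • (0:ℝ) + (l / R) • (-θ * R) = -θ * l := by
    simp only [smul_eq_mul]; field_simp; ring
  rw [e] at hc
  simp only [smul_eq_mul, Real.exp_zero] at hc
  refine hc.trans (le_of_eq ?_)
  field_simp; ring

lemma exp_le_chord {B : Matrix n n ℂ} {R θ : ℝ} (hR : 0 < R) (hB : B.PosSemidef)
    (hB' : (R • (1 : Matrix n n ℂ) - B).PosSemidef) :
    ((1 : Matrix n n ℂ) - ((1 - Real.exp (-θ * R)) / R) • B - exp (-θ • B)).PosSemidef := by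
  obtain ⟨U, hs, hsp, he, hl⟩ := spec_form hB.1 (-θ) R (-1)
  obtain ⟨V, hs', hsp', he', hl'⟩ := spec_form hB.1 (-θ) 1 (-((1 - Real.exp (-θ * R)) / R))
  have hle : ∀ i, hB.1.eigenvalues i ≤ R := by
    rw [neg_one_smul, ← sub_eq_add_neg] at hl
    rw [hl, U.isUnit.posSemidef_star_right_conjugate_iff, posSemidef_diagonal_iff] at hB'
    intro i
    have := hB' i
    have := (Complex.le_def.1 this).1
    simp at this
    linarith
  have e : (1 : Matrix n n ℂ) - ((1 - Real.exp (-θ * R)) / R) • B - exp (-θ • B) =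
      V * (diagonal (fun i => ((1 + -((1 - Real.exp (-θ * R)) / R) * hB.1.eigenvalues i : ℝ) : ℂ)) -
        diagonal (fun i => ((Real.exp (-θ * hB.1.eigenvalues i) : ℝ) : ℂ))) * star (V : Matrix n n ℂ) := by
    rw [mul_sub, sub_mul, ← he', ← hl', one_smul, neg_smul ((1 - Real.exp (-θ * R)) / R) B,
      sub_eq_add_neg 1]
  rw [e, V.isUnit.posSemidef_star_right_conjugate_iff, diagonal_sub, posSemidef_diagonal_iff]
  intro i
  have := chord (θ := θ) hR (hB.eigenvalues_nonneg i) (hle i)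
  rw [← Complex.ofReal_sub]
  exact_mod_cast (by linarith :
    0 ≤ 1 + -((1 - Real.exp (-θ * R)) / R) * hB.1.eigenvalues i - Real.exp (-θ * hB.1.eigenvalues i))

lemma one_le_trace_exp {T : Matrix n n ℂ} (hT : T.IsHermitian) (hT' : ¬ T.PosSemidef) {θ : ℝ}
    (hθ : 0 ≤ θ) : 1 ≤ (exp (-θ • T)).trace.re := by
  obtain ⟨U, hs, hsp, he, hl⟩ := spec_form hT (-θ) 0 0
  rw [hT.posSemidef_iff_eigenvalues_nonneg, Pi.le_def] at hT'
  push Not at hT'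
  obtain ⟨i, hi⟩ := hT'
  rw [he, hs, Matrix.trace_mul_comm, ← mul_assoc, Units.inv_mul, one_mul, trace_diagonal,
    ← Complex.ofReal_sum, Complex.ofReal_re]
  have h1 : (1:ℝ) ≤ Real.exp (-θ * hT.eigenvalues i) :=
    Real.one_le_exp (by simp only [Pi.zero_apply] at hi; nlinarith)
  exact h1.trans (Finset.single_le_sum (f := fun i => Real.exp (-θ * hT.eigenvalues i))
    (fun j _ => (Real.exp_pos _).le) (Finset.mem_univ i))

end spec

section cont
open NormedSpace
variable {n : Type*} [Fintype n] [DecidableEq n] [Nonempty n]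
attribute [local instance] Matrix.linftyOpNormedRing Matrix.linftyOpNormedAlgebra
lemma continuous_trexp : Continuous fun M : n → n → ℂ => (exp (Matrix.of M)).trace.re := by
  have h : Continuous (exp : Matrix n n ℂ → Matrix n n ℂ) := by
    exact NormedSpace.exp_continuous
  exact Complex.continuous_re.comp ((h.comp continuous_id).matrix_trace)

end cont

section prob
open NormedSpace
variable {n : Type*} [Fintype n] [DecidableEq n] [Nonempty n]

lemma step_pt {A B : Matrix n n ℂ} {R θ : ℝ} (hR : 0 < R) (hA : A.IsHermitian) (hB : B.PosSemidef)
    (hB' : (R • (1 : Matrix n n ℂ) - B).PosSemidef) :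
    (exp (A - θ • B)).trace.re ≤
      (exp A).trace.re - ((1 - Real.exp (-θ * R)) / R) * (exp A * B).trace.re := by
  have h1 := golden_thompson A (-θ • B) hA (exp_herm_smul hB.1 _)
  have h2 := trace_exp_mul_nonneg hA (exp_le_chord (θ := θ) hR hB hB')
  rw [neg_smul, ← sub_eq_add_neg] at h1
  rw [mul_sub, mul_sub, trace_sub, trace_sub, mul_one, Complex.sub_re, Complex.sub_re,
    mul_smul_comm, trace_smul, neg_smul] at h2
  rw [Complex.real_smul, Complex.re_ofReal_mul] at h2
  linarith

variable {Ω : Type*} [MeasurableSpace Ω] (ρ : Measure Ω) [IsProbabilityMeasure ρ]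

lemma integrable_tr {G : Ω → Matrix n n ℂ} (hGi : ∀ i j, Integrable (fun x => G x i j) ρ)
    (W : Matrix n n ℂ) : Integrable (fun x => (W * G x).trace) ρ := by
  simp only [Matrix.trace, Matrix.diag, Matrix.mul_apply]
  exact integrable_finsetSum _ fun i _ => integrable_finsetSum _ fun j _ => (hGi j i).const_mul _

lemma integral_tr {G : Ω → Matrix n n ℂ} (hGi : ∀ i j, Integrable (fun x => G x i j) ρ)
    (hI : ∀ i j, ∫ x, G x i j ∂ρ = (1 : Matrix n n ℂ) i j)
    (W : Matrix n n ℂ) : ∫ x, (W * G x).trace ∂ρ = W.trace := by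
  have : W.trace = (W * 1).trace := by rw [mul_one]
  rw [this]
  simp only [Matrix.trace, Matrix.diag, Matrix.mul_apply]
  have h : ∀ i j, Integrable (fun x => W i j * G x j i) ρ := fun i j => (hGi j i).const_mul _
  refine (integral_finsetSum _ fun i _ => integrable_finsetSum _ fun j _ => h i j).trans ?_
  refine Finset.sum_congr rfl fun i _ => ?_
  refine (integral_finsetSum _ fun j _ => h i j).trans ?_
  refine Finset.sum_congr rfl fun j _ => ?_
  rw [integral_const_mul, hI]

lemma step_int {G : Ω → Matrix n n ℂ} {R θ : ℝ} (hR : 0 < R)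
    (hG : ∀ x, (G x).PosSemidef) (hG' : ∀ x, (R • (1 : Matrix n n ℂ) - G x).PosSemidef)
    (hGi : ∀ i j, Integrable (fun x => G x i j) ρ)
    (hI : ∀ i j, ∫ x, G x i j ∂ρ = (1 : Matrix n n ℂ) i j)
    {A : Matrix n n ℂ} (hA : A.IsHermitian) :
    ∫⁻ x, ENNReal.ofReal (exp (A - θ • G x)).trace.re ∂ρ ≤
      ENNReal.ofReal (Real.exp (-((1 - Real.exp (-θ * R)) / R)) * (exp A).trace.re) := by
  set a := (1 - Real.exp (-θ * R)) / R with ha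
  have hti : Integrable (fun x => (exp A * G x).trace) ρ := integrable_tr ρ hGi _
  have htI : ∫ x, (exp A * G x).trace ∂ρ = (exp A).trace := integral_tr ρ hGi hI _
  have htre : ∫ x, (exp A * G x).trace.re ∂ρ = (exp A).trace.re := by
    rw [← htI]; exact integral_re hti
  have hpt := fun x => step_pt (θ := θ) hR hA (hG x) (hG' x)
  have hnn : ∀ x, 0 ≤ (exp A).trace.re - a * (exp A * G x).trace.re := fun x =>
    (trace_exp_nonneg (hA.sub (exp_herm_smul (hG x).1 θ))).trans (hpt x)
  have hre : Integrable (fun x => (exp A * G x).trace.re) ρ := hti.re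
  calc ∫⁻ x, ENNReal.ofReal (exp (A - θ • G x)).trace.re ∂ρ
      ≤ ∫⁻ x, ENNReal.ofReal ((exp A).trace.re - a * (exp A * G x).trace.re) ∂ρ :=
        lintegral_mono fun x => ENNReal.ofReal_le_ofReal (hpt x)
    _ = ENNReal.ofReal (∫ x, ((exp A).trace.re - a * (exp A * G x).trace.re) ∂ρ) := by
        exact (ofReal_integral_eq_lintegral_ofReal ((integrable_const _).sub (hre.const_mul a))
          (Filter.Eventually.of_forall hnn)).symm
    _ = ENNReal.ofReal ((1 - a) * (exp A).trace.re) := by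
        rw [integral_sub (integrable_const _) (hre.const_mul a), integral_const_mul, htre]
        simp; ring_nf
    _ ≤ _ := by
        apply ENNReal.ofReal_le_ofReal
        have h1 := Real.add_one_le_exp (-a)
        exact mul_le_mul_of_nonneg_right (by linarith) (trace_exp_nonneg hA)

lemma iter_int {G : Ω → Matrix n n ℂ} {R θ : ℝ} (hR : 0 < R)
    (hG : ∀ x, (G x).PosSemidef) (hG' : ∀ x, (R • (1 : Matrix n n ℂ) - G x).PosSemidef)
    (hm : ∀ i j, Measurable (fun x => G x i j))
    (hGi : ∀ i j, Integrable (fun x => G x i j) ρ)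
    (hI : ∀ i j, ∫ x, G x i j ∂ρ = (1 : Matrix n n ℂ) i j) (K : ℕ) :
    ∀ {A : Matrix n n ℂ} (_ : A.IsHermitian),
    ∫⁻ z, ENNReal.ofReal (exp (A - θ • ∑ i, G (z i))).trace.re ∂(Measure.pi fun _ : Fin K => ρ) ≤
      ENNReal.ofReal (Real.exp (-((1 - Real.exp (-θ * R)) / R)) ^ K * (exp A).trace.re) := by
  set c := Real.exp (-((1 - Real.exp (-θ * R)) / R)) with hc
  have hc0 : 0 ≤ c := (Real.exp_pos _).le
  induction K with
  | zero => intro A hA; simp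
  | succ K ih =>
    intro A hA
    have hcK : 0 ≤ c ^ K := pow_nonneg hc0 K
    set f : Ω × (Fin K → Ω) → ENNReal := fun p =>
      ENNReal.ofReal (exp (A - θ • G p.1 - θ • ∑ i, G (p.2 i))).trace.re with hf
    have hfm : Measurable f := by
      apply ENNReal.measurable_ofReal.comp
      have h1 : Measurable fun p : Ω × (Fin K → Ω) =>
          (fun k l => (A - θ • G p.1 - θ • ∑ i, G (p.2 i)) k l : n → n → ℂ) := by
        refine measurable_pi_lambda _ fun k => measurable_pi_lambda _ fun l => ?_
        simp only [Matrix.sub_apply, Matrix.smul_apply, Matrix.sum_apply]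
        have h2 : ∀ i : Fin K, Measurable fun p : Ω × (Fin K → Ω) => G (p.2 i) k l := fun i =>
          (hm k l).comp ((measurable_pi_apply i).comp measurable_snd)
        have h3 : Measurable fun p : Ω × (Fin K → Ω) => G p.1 k l := (hm k l).comp measurable_fst
        exact (measurable_const.sub (h3.const_smul θ)).sub
          ((Finset.measurable_fun_sum _ fun i _ => h2 i).const_smul θ)
      exact continuous_trexp.measurable.comp h1
    have hmp := measurePreserving_piFinSuccAbove (fun _ : Fin (K + 1) => ρ) 0
    have e1 : ∫⁻ z, ENNReal.ofReal (exp (A - θ • ∑ i, G (z i))).trace.re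
        ∂(Measure.pi fun _ : Fin (K + 1) => ρ) = ∫⁻ p, f p ∂(ρ.prod (Measure.pi fun _ : Fin K => ρ)) := by
      rw [← hmp.lintegral_comp hfm]
      refine lintegral_congr fun z => ?_
      simp only [hf, Fin.sum_univ_succ, smul_add, sub_sub]
      rfl
    rw [e1, lintegral_prod _ hfm.aemeasurable]
    calc ∫⁻ x, ∫⁻ w, f (x, w) ∂(Measure.pi fun _ : Fin K => ρ) ∂ρ
        ≤ ∫⁻ x, ENNReal.ofReal (c ^ K) * ENNReal.ofReal (exp (A - θ • G x)).trace.re ∂ρ := by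
          refine lintegral_mono fun x => ?_
          have hx := ih (A := A - θ • G x) (hA.sub (exp_herm_smul (hG x).1 θ))
          rw [ENNReal.ofReal_mul hcK] at hx
          exact hx
      _ = ENNReal.ofReal (c ^ K) * ∫⁻ x, ENNReal.ofReal (exp (A - θ • G x)).trace.re ∂ρ :=
          lintegral_const_mul' _ _ ENNReal.ofReal_ne_top
      _ ≤ ENNReal.ofReal (c ^ K) * ENNReal.ofReal (c * (exp A).trace.re) := by
          gcongr
          exact step_int ρ hR hG hG' hGi hI hA
      _ = _ := by
          rw [← ENNReal.ofReal_mul hcK, pow_succ, mul_assoc]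

lemma chernoff {G : Ω → Matrix n n ℂ} {R θ s : ℝ} (hR : 0 < R) (hθ : 0 ≤ θ)
    (hG : ∀ x, (G x).PosSemidef) (hG' : ∀ x, (R • (1 : Matrix n n ℂ) - G x).PosSemidef)
    (hm : ∀ i j, Measurable (fun x => G x i j))
    (hGi : ∀ i j, Integrable (fun x => G x i j) ρ)
    (hI : ∀ i j, ∫ x, G x i j ∂ρ = (1 : Matrix n n ℂ) i j) (K : ℕ) :
    (Measure.pi fun _ : Fin K => ρ) {z | ¬ (∑ i, G (z i) - s • (1 : Matrix n n ℂ)).PosSemidef} ≤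
      ENNReal.ofReal (Real.exp (-((1 - Real.exp (-θ * R)) / R)) ^ K *
        (Real.exp (θ * s) * Fintype.card n)) := by
  have hA : ((θ * s) • (1 : Matrix n n ℂ)).IsHermitian := exp_herm_smul isHermitian_one _
  have h := iter_int (θ := θ) ρ hR hG hG' hm hGi hI K hA
  have he : (exp ((θ * s) • (1 : Matrix n n ℂ))).trace.re = Real.exp (θ * s) * Fintype.card n := by
    have e1 : (θ * s) • (1 : Matrix n n ℂ) = diagonal (fun _ => ((θ * s : ℝ) : ℂ)) := by
      ext i j
      by_cases h : i = j <;> simp [diagonal, h]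
    rw [e1, Matrix.exp_diagonal, trace_diagonal]
    have e2 : ∀ i : n, exp (fun _ : n => ((θ * s : ℝ) : ℂ)) i = ((Real.exp (θ * s) : ℝ) : ℂ) := fun i => by
      rw [Pi.exp_def]; simp [Complex.exp_eq_exp_ℂ]
    simp only [e2]
    rw [← Complex.ofReal_sum, Complex.ofReal_re]
    simp [mul_comm]
  rw [he] at h
  refine le_trans ?_ h
  refine le_trans ?_ (mul_meas_ge_le_lintegral₀ (ε := 1) ?_)
  · rw [one_mul]
    apply measure_mono
    intro z hz
    have hH : (∑ i, G (z i) - s • (1 : Matrix n n ℂ)).IsHermitian :=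
      (posSemidef_sum _ fun i _ => hG (z i)).1.sub (exp_herm_smul isHermitian_one _)
    have := one_le_trace_exp hH hz hθ
    have e3 : -θ • (∑ i, G (z i) - s • (1 : Matrix n n ℂ)) =
        (θ * s) • (1 : Matrix n n ℂ) - θ • ∑ i, G (z i) := by
      rw [smul_sub, smul_smul, neg_smul, neg_mul, neg_smul]; abel
    rw [e3] at this
    simpa using this
  · apply Measurable.aemeasurable
    apply ENNReal.measurable_ofReal.comp
    have h1 : Measurable fun z : Fin K → Ω =>
        (fun k l => ((θ * s) • (1 : Matrix n n ℂ) - θ • ∑ i, G (z i)) k l : n → n → ℂ) := by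
      refine measurable_pi_lambda _ fun k => measurable_pi_lambda _ fun l => ?_
      simp only [Matrix.sub_apply, Matrix.smul_apply, Matrix.sum_apply]
      have h2 : ∀ i : Fin K, Measurable fun p : Fin K → Ω => G (p i) k l := fun i =>
        (hm k l).comp (measurable_pi_apply i)
      exact measurable_const.sub
        ((Finset.measurable_fun_sum _ fun i _ => h2 i).const_smul θ)
    exact continuous_trexp.measurable.comp h1
end prob

section final
open scoped ComplexConjugate
variable {Ω : Type*} [MeasurableSpace Ω] (ρ : Measure Ω) [IsProbabilityMeasure ρ]

lemma nik_zero {P : Submodule ℂ (Ω → ℂ)} {nik : ℝ}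
    (hnik : ∀ p ∈ P, ∀ x, ‖p x‖ ≤ nik * Real.sqrt (∫ z, ‖p z‖ ^ 2 ∂ρ)) {p : Ω → ℂ} (hp : p ∈ P)
    (h : ∫ z, ‖p z‖ ^ 2 ∂ρ = 0) : p = 0 := by
  ext x
  have := hnik p hp x
  rw [h] at this
  simpa using this

lemma nik_int {P : Submodule ℂ (Ω → ℂ)} {nik : ℝ}
    (hnik : ∀ p ∈ P, ∀ x, ‖p x‖ ≤ nik * Real.sqrt (∫ z, ‖p z‖ ^ 2 ∂ρ)) {p : Ω → ℂ} (hp : p ∈ P) :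
    Integrable (fun z => ‖p z‖ ^ 2) ρ := by
  by_contra hc
  have := nik_zero ρ hnik hp (integral_undef hc)
  subst this
  simp at hc

lemma nik_int2 {P : Submodule ℂ (Ω → ℂ)} {nik : ℝ}
    (hnik : ∀ p ∈ P, ∀ x, ‖p x‖ ≤ nik * Real.sqrt (∫ z, ‖p z‖ ^ 2 ∂ρ)) {p q : Ω → ℂ} (hp : p ∈ P)
    (hq : q ∈ P) : Integrable (fun z => conj (p z) * q z) ρ := by
  have h1 := (nik_int ρ hnik (P.add_mem hp hq)).ofReal (𝕜 := ℂ)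
  have h2 := (nik_int ρ hnik (P.sub_mem hp hq)).ofReal (𝕜 := ℂ)
  have h3 := (nik_int ρ hnik (P.sub_mem hp (P.smul_mem Complex.I hq))).ofReal (𝕜 := ℂ)
  have h4 := (nik_int ρ hnik (P.add_mem hp (P.smul_mem Complex.I hq))).ofReal (𝕜 := ℂ)
  have h5 := ((h1.sub h2).add ((h3.sub h4).mul_const Complex.I)).div_const 4
  refine h5.congr (Filter.Eventually.of_forall fun z => ?_)
  have := inner_eq_sum_norm_sq_div_four (𝕜 := ℂ) (p z) (q z)
  simp only [RCLike.inner_apply] at this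
  rw [mul_comm] at this
  refine Eq.trans ?_ this.symm
  simp

lemma exists_basis {P : Submodule ℂ (Ω → ℂ)} {nik : ℝ} {N : ℕ} (hN : 0 < N)
    (hdim : Module.finrank ℂ P = N)
    (hnik : ∀ p ∈ P, ∀ x, ‖p x‖ ≤ nik * Real.sqrt (∫ z, ‖p z‖ ^ 2 ∂ρ)) :
    ∃ e : Fin N → Ω → ℂ, (∀ i, e i ∈ P) ∧
      (∀ p ∈ P, ∃ u : Fin N → ℂ, p = ∑ i, u i • e i) ∧
      (∀ u : Fin N → ℂ, ∫ x, ‖(∑ i, u i • e i) x‖ ^ 2 ∂ρ = ∑ i, ‖u i‖ ^ 2) ∧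
      ∀ i j, ∫ x, conj (e i x) * e j x ∂ρ = (1 : Matrix (Fin N) (Fin N) ℂ) i j := by
  subst hdim
  have hself : ∀ p : P, ∫ x, conj (p.1 x) * p.1 x ∂ρ = ((∫ x, ‖p.1 x‖ ^ 2 ∂ρ : ℝ) : ℂ) := fun p => by
    refine Eq.trans ?_ (integral_complex_ofReal (f := fun x => ‖p.1 x‖ ^ 2))
    refine integral_congr_ae (Filter.Eventually.of_forall fun x => ?_)
    simp [Complex.conj_mul']
  let core : InnerProductSpace.Core ℂ P :=
    { inner := fun p q => ∫ x, conj (p.1 x) * q.1 x ∂ρ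
      conj_inner_symm := fun p q => by
        rw [← integral_conj]
        refine integral_congr_ae (Filter.Eventually.of_forall fun x => ?_)
        simp [mul_comm]
      re_inner_nonneg := fun p => by
        rw [hself]
        simp only [RCLike.re_to_complex, Complex.ofReal_re]
        exact integral_nonneg fun x => by positivity
      add_left := fun p q r => by
        rw [← integral_add (nik_int2 ρ hnik p.2 r.2) (nik_int2 ρ hnik q.2 r.2)]
        refine integral_congr_ae (Filter.Eventually.of_forall fun x => ?_)
        simp [add_mul]
      smul_left := fun p q c => by
        rw [← integral_const_mul]
        refine integral_congr_ae (Filter.Eventually.of_forall fun x => ?_)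
        simp [mul_assoc]
      definite := fun p hp => by
        rw [hself] at hp
        exact Subtype.ext (nik_zero ρ hnik p.2 (by exact_mod_cast hp)) }
  letI : NormedAddCommGroup P := core.toNormedAddCommGroup
  letI : InnerProductSpace ℂ P := InnerProductSpace.ofCore core.toCore
  haveI : FiniteDimensional ℂ P := Module.finite_of_finrank_pos hN
  have hin : ∀ p q : P, inner ℂ p q = ∫ x, conj (p.1 x) * q.1 x ∂ρ := fun p q => rfl
  let b := stdOrthonormalBasis ℂ P
  refine ⟨fun i => (b i).1, fun i => (b i).2, fun p hp => ⟨fun i => b.repr ⟨p, hp⟩ i, ?_⟩, fun u => ?_,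
    fun i j => ?_⟩
  · have := congrArg Subtype.val (b.sum_repr ⟨p, hp⟩)
    simpa using this.symm
  · have h1 : ∑ i, u i • (b i).1 = (b.repr.symm (WithLp.toLp 2 u)).1 := by
      rw [← b.sum_repr_symm]; simp
    rw [h1]
    have h2 := hself (b.repr.symm (WithLp.toLp 2 u))
    rw [← hin, inner_self_eq_norm_sq_to_K, LinearIsometryEquiv.norm_map] at h2
    have h3 : ‖WithLp.toLp 2 u‖ ^ 2 = ∫ x, ‖(b.repr.symm (WithLp.toLp 2 u)).1 x‖ ^ 2 ∂ρ := by
      have h4 := congrArg Complex.re h2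
      rw [Complex.ofReal_re] at h4
      rw [← h4]
      change _ = (((‖WithLp.toLp 2 u‖ : ℝ) : ℂ) ^ 2).re
      rw [← Complex.ofReal_pow, Complex.ofReal_re]
    rw [← h3, EuclideanSpace.norm_sq_eq]
  · rw [← hin, orthonormal_iff_ite.1 b.orthonormal, Matrix.one_apply]

lemma quad {n : Type*} [Fintype n] (u v : n → ℂ) :
    star u ⬝ᵥ (vecMulVec (star v) v *ᵥ u) = ((‖v ⬝ᵥ u‖ ^ 2 : ℝ) : ℂ) := by
  rw [vecMulVec_mulVec]
  have : star u ⬝ᵥ star v = conj (v ⬝ᵥ u) := by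
    simp [dotProduct, map_sum, mul_comm]
  simp [this, Complex.conj_mul', Complex.mul_conj']

lemma quad_one {n : Type*} [Fintype n] [DecidableEq n] (u : n → ℂ) (R : ℝ) :
    star u ⬝ᵥ ((R • (1 : Matrix n n ℂ)) *ᵥ u) = ((R * ∑ i, ‖u i‖ ^ 2 : ℝ) : ℂ) := by
  rw [smul_mulVec, one_mulVec, dotProduct_smul, dotProduct]
  simp [Complex.conj_mul']

lemma c_pos {δ : ℝ} (hδ : δ ∈ Set.Ioo (0 : ℝ) 1) : 0 < (1 - δ) * Real.log (1 - δ) + δ := by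
  have hy : 0 < 1 - δ := by linarith [hδ.2]
  have h := Real.log_lt_sub_one_of_pos (inv_pos.2 hy) (by
    intro h; rw [inv_eq_one] at h; linarith [hδ.1])
  rw [Real.log_inv] at h
  have := mul_lt_mul_of_pos_left h hy
  rw [mul_sub, mul_inv_cancel₀ hy.ne'] at this
  linarith

lemma numeric {R δ γ θ : ℝ} {N K : ℕ} (hR : 0 < R) (hN : 0 < N) (hδ : δ ∈ Set.Ioo (0 : ℝ) 1)
    (hγ : γ ∈ Set.Ioo (0 : ℝ) 1)
    (hK : R * ((1 - δ) * Real.log (1 - δ) + δ)⁻¹ * Real.log (N / γ) ≤ K)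
    (hθ : θ = -Real.log (1 - δ) / R) :
    Real.exp (-((1 - Real.exp (-θ * R)) / R)) ^ K * (Real.exp (θ * ((1 - δ) * K)) * N) ≤ γ := by
  have hy : 0 < 1 - δ := by linarith [hδ.2]
  have hc := c_pos hδ
  have e1 : -θ * R = Real.log (1 - δ) := by rw [hθ]; field_simp
  have hN' : (0:ℝ) < N := by exact_mod_cast hN
  rw [e1, Real.exp_log hy, ← Real.exp_nat_mul, ← mul_assoc, ← Real.exp_add]
  have e2 : (K:ℝ) * -((1 - (1 - δ)) / R) + θ * ((1 - δ) * K) =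
      -(K * ((1 - δ) * Real.log (1 - δ) + δ) / R) := by rw [hθ]; field_simp; ring
  rw [e2]
  have h1 : Real.log (N / γ) ≤ K * ((1 - δ) * Real.log (1 - δ) + δ) / R := by
    rw [le_div_iff₀ hR]
    calc Real.log (N / γ) * R = (R * ((1 - δ) * Real.log (1 - δ) + δ)⁻¹ * Real.log (N / γ)) *
          ((1 - δ) * Real.log (1 - δ) + δ) := by field_simp
      _ ≤ _ := mul_le_mul_of_nonneg_right hK hc.le
  have h2 : Real.exp (-(K * ((1 - δ) * Real.log (1 - δ) + δ) / R)) ≤ Real.exp (-Real.log (N / γ)) :=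
    Real.exp_le_exp.2 (by linarith)
  rw [Real.exp_neg (Real.log _), Real.exp_log (div_pos hN' hγ.1)] at h2
  calc _ ≤ (N / γ)⁻¹ * (N:ℝ) := mul_le_mul_of_nonneg_right h2 hN'.le
    _ = γ := by have := hγ.1; field_simp
end final
end S15

open Matrix ComplexOrder in
theorem stmt15_aux {Ω : Type*} [MeasurableSpace Ω]
    (ρ : Measure Ω) [IsProbabilityMeasure ρ]
    (N : ℕ) (hN : 0 < N) (P : Submodule ℂ (Ω → ℂ))
    (hdim : Module.finrank ℂ P = N)
    (nik : ℝ) (hnik0 : 0 ≤ nik)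
    (hnik : ∀ p ∈ P, ∀ x, ‖p x‖ ≤ nik * Real.sqrt (∫ z, ‖p z‖ ^ 2 ∂ρ))
    (δ γ : ℝ) (hδ : δ ∈ Set.Ioo (0 : ℝ) 1) (hγ : γ ∈ Set.Ioo (0 : ℝ) 1)
    (K : ℕ)
    (hK : nik ^ 2 * ((1 - δ) * Real.log (1 - δ) + δ)⁻¹ * Real.log (N / γ) ≤ K) :
    (Measure.pi fun _ : Fin K => ρ) {z : Fin K → Ω |
      ∀ p ∈ P, Real.sqrt (∫ x, ‖p x‖ ^ 2 ∂ρ)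
        ≤ (Real.sqrt (1 - δ))⁻¹ * Real.sqrt ((K : ℝ)⁻¹ * ∑ i, ‖p (z i)‖ ^ 2)}ᶜ
      ≤ ENNReal.ofReal γ := by
  classical
  obtain ⟨e, heP, hspan, hnorm, horth⟩ := S15.exists_basis ρ hN hdim hnik
  haveI : Nonempty (Fin N) := ⟨⟨0, hN⟩⟩
  have hy : 0 < 1 - δ := by linarith [hδ.2]
  have hnpos : 0 < nik := by
    rcases hnik0.lt_or_eq with h | h
    · exact h
    · exfalso
      have h0 : ∀ p ∈ P, p = 0 := fun p hp => by
        ext x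
        have := hnik p hp x
        rw [← h] at this
        simpa using this
      have : P = ⊥ := by rw [Submodule.eq_bot_iff]; exact h0
      rw [this] at hdim
      simp at hdim
      omega
  have hR : 0 < nik ^ 2 := by positivity
  have hKpos : (0:ℝ) < K := by
    refine lt_of_lt_of_le ?_ hK
    have hN1 : (1:ℝ) ≤ N := by exact_mod_cast hN
    have : 0 < Real.log (N / γ) :=
      Real.log_pos (by rw [lt_div_iff₀ hγ.1]; linarith [hγ.2])
    have := S15.c_pos hδ
    positivity
  -- the Gram matrices
  set v : Ω → Fin N → ℂ := fun x i => e i x with hv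
  have hvu : ∀ (u : Fin N → ℂ) x, v x ⬝ᵥ u = (∑ i, u i • e i) x := fun u x => by
    simp [dotProduct, hv, Finset.sum_apply, mul_comm]
  set G0 : Ω → Matrix (Fin N) (Fin N) ℂ := fun x => vecMulVec (star (v x)) (v x) with hG0
  have hG0int : ∀ i j, Integrable (fun x => G0 x i j) ρ := fun i j =>
    S15.nik_int2 ρ hnik (heP i) (heP j)
  have hG0I : ∀ i j, ∫ x, G0 x i j ∂ρ = (1 : Matrix (Fin N) (Fin N) ℂ) i j := horth
  have hG0R : ∀ x, ((nik ^ 2) • (1 : Matrix (Fin N) (Fin N) ℂ) - G0 x).PosSemidef := fun x => by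
    refine PosSemidef.of_dotProduct_mulVec_nonneg
      ((S15.exp_herm_smul isHermitian_one _).sub (posSemidef_vecMulVec_star_self _).1) fun u => ?_
    rw [sub_mulVec, dotProduct_sub, S15.quad_one, S15.quad, ← Complex.ofReal_sub]
    have h1 := hnik _ (P.sum_mem fun i _ => P.smul_mem (u i) (heP i) : ∑ i, u i • e i ∈ P) x
    rw [hnorm u, ← hvu] at h1
    have h2 : ‖v x ⬝ᵥ u‖ ^ 2 ≤ nik ^ 2 * ∑ i, ‖u i‖ ^ 2 := by
      calc _ ≤ (nik * Real.sqrt (∑ i, ‖u i‖ ^ 2)) ^ 2 := by gcongr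
        _ = _ := by rw [mul_pow, Real.sq_sqrt (by positivity)]
    exact_mod_cast sub_nonneg.2 h2
  -- measurable modification
  set T : Set Ω := toMeasurable ρ {x | ¬ ∀ i j, G0 x i j = (hG0int i j).1.mk _ x} with hT
  have hTm : MeasurableSet T := measurableSet_toMeasurable _ _
  have hT0 : ρ T = 0 := by
    rw [hT, measure_toMeasurable]
    have : ∀ᵐ x ∂ρ, ∀ i j, G0 x i j = (hG0int i j).1.mk _ x :=
      ae_all_iff.2 fun i => ae_all_iff.2 fun j => (hG0int i j).1.ae_eq_mk
    exact this
  have hTc : ∀ x, x ∉ T → ∀ i j, G0 x i j = (hG0int i j).1.mk _ x := fun x hx => by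
    by_contra hc
    exact hx (subset_toMeasurable _ _ hc)
  set G : Ω → Matrix (Fin N) (Fin N) ℂ := fun x => if x ∈ T then 0 else G0 x with hG
  have hGae : ∀ᵐ x ∂ρ, G x = G0 x := by
    have : ∀ᵐ x ∂ρ, x ∉ T := measure_eq_zero_iff_ae_notMem.1 hT0
    filter_upwards [this] with x hx
    simp [hG, hx]
  have hGae' : ∀ i j, (fun x => G0 x i j) =ᵐ[ρ] fun x => G x i j := fun i j => by
    filter_upwards [hGae] with x hx
    rw [hx]
  have hcher := S15.chernoff (G := G) (R := nik ^ 2) (θ := -Real.log (1 - δ) / nik ^ 2)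
    (s := (1 - δ) * K) ρ hR
    (div_nonneg (neg_nonneg.2 (Real.log_nonpos hy.le (by linarith [hδ.1]))) hR.le)
    (fun x => by
      by_cases hx : x ∈ T
      · simp only [hG, hx, if_true]; exact PosSemidef.zero
      · simp only [hG, hx, if_false]; exact posSemidef_vecMulVec_star_self _)
    (fun x => by
      by_cases hx : x ∈ T
      · simp only [hG, hx, if_true, sub_zero]; exact PosSemidef.one.smul hR.le
      · simp only [hG, hx, if_false]; exact hG0R x)
    (fun i j => by
      have : (fun x => G x i j) = fun x => if x ∈ T then 0 else (hG0int i j).1.mk _ x := by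
        ext x
        by_cases hx : x ∈ T
        · simp [hG, hx]
        · simp only [hG, hx, if_false]; exact hTc x hx i j
      rw [this]
      exact Measurable.ite hTm measurable_const (hG0int i j).1.stronglyMeasurable_mk.measurable)
    (fun i j => (hG0int i j).congr (hGae' i j))
    (fun i j => by rw [← hG0I i j]; exact (integral_congr_ae (hGae' i j)).symm) K
  have hnum := S15.numeric hR hN hδ hγ hK rfl
  rw [Fintype.card_fin] at hcher
  refine le_trans ?_ (hcher.trans (ENNReal.ofReal_le_ofReal hnum))
  apply measure_mono_ae
  have hzT : ∀ᵐ z ∂(Measure.pi fun _ : Fin K => ρ), ∀ i, G (z i) = G0 (z i) :=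
    ae_all_iff.2 fun i => (Measure.quasiMeasurePreserving_eval (fun _ : Fin K => ρ) i).ae hGae
  filter_upwards [hzT] with z hz hbad
  refine fun hpsd => hbad ?_
  intro p hp
  obtain ⟨u, rfl⟩ := hspan p hp
  have h1 := hpsd.dotProduct_mulVec_nonneg u
  rw [sub_mulVec, dotProduct_sub, S15.quad_one, sum_mulVec, dotProduct_sum] at h1
  have h2 : ∀ i, star u ⬝ᵥ (G (z i) *ᵥ u) = ((‖(∑ j, u j • e j) (z i)‖ ^ 2 : ℝ) : ℂ) := fun i => by
    rw [hz i, hG0, S15.quad, hvu]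
  simp only [h2] at h1
  rw [← Complex.ofReal_sum, ← Complex.ofReal_sub, ← hnorm u] at h1
  have h3 := sub_nonneg.1 (Complex.zero_le_real.1 h1)
  rw [← Real.sqrt_inv, ← Real.sqrt_mul (by positivity)]
  apply Real.sqrt_le_sqrt
  rw [inv_mul_eq_div, le_div_iff₀ hy, inv_mul_eq_div, le_div_iff₀ hKpos]
  linarith



/-- If `z₁,…,z_K` are drawn i.i.d. from `ρ` and
`K ≥ N(P,ρ)² ((1−δ)log(1−δ)+δ)⁻¹ log(N/γ)`, then with probability at least `1−γ` the
constant `D` comparing `‖·‖_{L²(ρ)}` with the discrete norm `‖·‖_{L²(τ)}`,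
`τ = K⁻¹ Σᵢ δ_{zᵢ}`, satisfies `D ≤ 1/√(1−δ)`. -/
theorem stmt15 {Ω : Type*} [MeasurableSpace Ω]
    (ρ : Measure Ω) [IsProbabilityMeasure ρ]
    (N : ℕ) (hN : 0 < N) (P : Submodule ℂ (Ω → ℂ))
    (hdim : Module.finrank ℂ P = N)
    (nik : ℝ) (hnik0 : 0 ≤ nik)
    (hnik : ∀ p ∈ P, ∀ x, ‖p x‖ ≤ nik * Real.sqrt (∫ z, ‖p z‖ ^ 2 ∂ρ))
    (δ γ : ℝ) (hδ : δ ∈ Set.Ioo (0 : ℝ) 1) (hγ : γ ∈ Set.Ioo (0 : ℝ) 1)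
    (K : ℕ)
    (hK : nik ^ 2 * ((1 - δ) * Real.log (1 - δ) + δ)⁻¹ * Real.log (N / γ) ≤ K) :
    ENNReal.ofReal (1 - γ) ≤ (Measure.pi fun _ : Fin K => ρ) {z : Fin K → Ω |
      ∀ p ∈ P, Real.sqrt (∫ x, ‖p x‖ ^ 2 ∂ρ)
        ≤ (Real.sqrt (1 - δ))⁻¹ * Real.sqrt ((K : ℝ)⁻¹ * ∑ i, ‖p (z i)‖ ^ 2)} := by
  have h := stmt15_aux ρ N hN P hdim nik hnik0 hnik δ γ hδ hγ K hK
  set S := {z : Fin K → Ω |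
      ∀ p ∈ P, Real.sqrt (∫ x, ‖p x‖ ^ 2 ∂ρ)
        ≤ (Real.sqrt (1 - δ))⁻¹ * Real.sqrt ((K : ℝ)⁻¹ * ∑ i, ‖p (z i)‖ ^ 2)} with hS
  have h1 : (1 : ENNReal) ≤ (Measure.pi fun _ : Fin K => ρ) S + ENNReal.ofReal γ := by
    calc (1 : ENNReal) = (Measure.pi fun _ : Fin K => ρ) (S ∪ Sᶜ) := by simp
      _ ≤ _ := (measure_union_le _ _).trans (by gcongr)
  rw [ENNReal.ofReal_sub _ hγ.1.le, ENNReal.ofReal_one]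
  exact tsub_le_iff_right.2 h1
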